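/- Let A be a unital ℤ-graded ring with elements t₋ ∈ A₁ and t₊ ∈ A₋₁ such that t₋t₊ = 1, A_i = t₋ⁱA₀ for every i > 0 and A_{-i} = A₀t₊ⁱ for every i > 0 (so A is the corner skew Laurent polynomial ring A₀[t₊,t₋;α] for the idempotent e = t₊t₋ and the corner isomorphism α(r) = t₊rt₋). If the idempotent e = t₊t₋ is full in A₀, i.e. the additive span of {r e r' : r, r' ∈ A₀} equals A₀, then A is strongly ℤ-graded: A_i A_j = A_{i+j} for all i,j ∈ ℤ. -/

import Mathlib

set_option maxHeartbeats 800000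

/-- For additive subgroups `X Y` of a (possibly non-unital) ring `B`, `sMul X Y` is the
additive span of the set of products `x * y` with `x ∈ X`, `y ∈ Y`. -/
def sMul {B : Type*} [NonUnitalRing B] (X Y : AddSubgroup B) : AddSubgroup B :=
  AddSubgroup.closure {z : B | ∃ x ∈ X, ∃ y ∈ Y, z = x * y}

/-- The `n`-fold product `X ⋯ X` of an additive subgroup of a ring, defined for `n ≥ 1`
(the value at `0` is junk). -/
def sPow {B : Type*} [NonUnitalRing B] (X : AddSubgroup B) : ℕ → AddSubgroup B
  | 0 => ⊥
  | 1 => X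
  | n + 2 => sMul (sPow X (n + 1)) X

/-- A ℤ-grading of a (possibly non-unital) ring `B`: an internal direct sum decomposition
into additive subgroups with `B_i B_j ⊆ B_{i+j}`. -/
structure ZGrading (B : Type*) [NonUnitalRing B] where
  comp : ℤ → AddSubgroup B
  isInternal : DirectSum.IsInternal comp
  mul_mem : ∀ {i j : ℤ} {x y : B}, x ∈ comp i → y ∈ comp j → x * y ∈ comp (i + j)

/-- `Ann_{A₀}(A₁) = {r ∈ A₀ : r·x = 0 for all x ∈ A₁}`. -/
def annA1 {A : Type*} [NonUnitalRing A] (G : ZGrading A) : Set A :=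
  {r | r ∈ G.comp 0 ∧ ∀ x ∈ G.comp 1, r * x = 0}

/-- For a subset `J` of `A₀`, `J^⊥ = {r ∈ A₀ : r x = 0 and x r = 0 for all x ∈ J}`. -/
def perp {A : Type*} [NonUnitalRing A] (G : ZGrading A) (J : Set A) : Set A :=
  {r | r ∈ G.comp 0 ∧ ∀ x ∈ J, r * x = 0 ∧ x * r = 0}

theorem mul_mem_sMul {B : Type*} [NonUnitalRing B] {X Y : AddSubgroup B} {x y : B}
    (hx : x ∈ X) (hy : y ∈ Y) : x * y ∈ sMul X Y :=
  AddSubgroup.subset_closure ⟨x, hx, y, hy, rfl⟩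

theorem sMul_le {B : Type*} [NonUnitalRing B] {X Y Z : AddSubgroup B} :
    sMul X Y ≤ Z ↔ ∀ x ∈ X, ∀ y ∈ Y, x * y ∈ Z := by
  refine ⟨fun h x hx y hy => h (mul_mem_sMul hx hy), fun h => ?_⟩
  rw [sMul, AddSubgroup.closure_le]
  rintro _ ⟨x, hx, y, hy, rfl⟩
  exact h x hx y hy

namespace ZGrading

theorem sMul_comp_le {B : Type*} [NonUnitalRing B] (G : ZGrading B) (i j : ℤ) :
    sMul (G.comp i) (G.comp j) ≤ G.comp (i + j) :=
  sMul_le.2 fun _ hx _ hy => G.mul_mem hx hy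

variable {A : Type*} [Ring A] (G : ZGrading A)

theorem sMul_comp_eq_of_one_mem {i : ℤ} (h : (1 : A) ∈ sMul (G.comp i) (G.comp (-i))) (j : ℤ) :
    sMul (G.comp i) (G.comp j) = G.comp (i + j) := by
  refine le_antisymm (G.sMul_comp_le i j) fun z hz => ?_
  have key : sMul (G.comp i) (G.comp (-i)) ≤
      (sMul (G.comp i) (G.comp j)).comap (AddMonoidHom.mulRight z) := by
    refine sMul_le.2 fun x hx y hy => ?_
    have hyz : y * z ∈ G.comp j := by simpa using G.mul_mem hy hz
    simpa [mul_assoc] using mul_mem_sMul hx hyz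
  simpa using key h

theorem one_mem_sMul_comp_add {i j : ℤ} (hi : (1 : A) ∈ sMul (G.comp i) (G.comp (-i)))
    (hj : (1 : A) ∈ sMul (G.comp j) (G.comp (-j))) :
    (1 : A) ∈ sMul (G.comp (i + j)) (G.comp (-(i + j))) := by
  refine sMul_le.2 (fun x hx y hy => ?_) hi
  have key : sMul (G.comp j) (G.comp (-j)) ≤ (sMul (G.comp (i + j)) (G.comp (-(i + j)))).comap
      ((AddMonoidHom.mulRight y).comp (AddMonoidHom.mulLeft x)) := by
    refine sMul_le.2 fun u hu v hv => ?_
    have hvy : v * y ∈ G.comp (-(i + j)) := by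
      rw [neg_add_rev]
      exact G.mul_mem hv hy
    simpa [mul_assoc] using mul_mem_sMul (G.mul_mem hx hu) hvy
  simpa using key hj

theorem sMul_comp_eq_of_one_mem_one_of_one_mem_neg_one
    (h₁ : (1 : A) ∈ sMul (G.comp 1) (G.comp (-1)))
    (h₂ : (1 : A) ∈ sMul (G.comp (-1)) (G.comp 1)) (i j : ℤ) :
    sMul (G.comp i) (G.comp j) = G.comp (i + j) := by
  refine G.sMul_comp_eq_of_one_mem ?_ j
  have h₂' : (1 : A) ∈ sMul (G.comp (-1)) (G.comp (- -1)) := by rwa [neg_neg]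
  induction i using Int.induction_on with
  | zero => simpa using G.one_mem_sMul_comp_add h₁ h₂'
  | succ n ih => exact G.one_mem_sMul_comp_add ih h₁
  | pred n ih => simpa only [sub_eq_add_neg] using G.one_mem_sMul_comp_add ih h₂'

end ZGrading

/-- Let `A` be a unital ℤ-graded ring with `t₋ ∈ A₁`, `t₊ ∈ A₋₁`, `t₋ t₊ = 1`,
`A_i = t₋ⁱ A₀` and `A_{-i} = A₀ t₊ⁱ` for `i > 0` (a corner skew Laurent polynomial ring).
If the idempotent `e = t₊ t₋` is full in `A₀`, then `A` is strongly ℤ-graded. -/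
theorem cornerSkewLaurent_strongly_graded_of_full
    {A : Type*} [Ring A] (G : ZGrading A) (tm tp : A)
    (htm : tm ∈ G.comp 1) (htp : tp ∈ G.comp (-1)) (hunit : tm * tp = 1)
    (hpos : ∀ n : ℕ,
      (G.comp ((n : ℤ) + 1) : Set A) = {x | ∃ r ∈ G.comp 0, x = tm ^ (n + 1) * r})
    (hneg : ∀ n : ℕ,
      (G.comp (-((n : ℤ) + 1)) : Set A) = {x | ∃ r ∈ G.comp 0, x = r * tp ^ (n + 1)})
    (hfull : AddSubgroup.closure
        {x : A | ∃ r ∈ G.comp 0, ∃ r' ∈ G.comp 0, x = r * (tp * tm) * r'} = G.comp 0) :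
    ∀ i j : ℤ, sMul (G.comp i) (G.comp j) = G.comp (i + j) := by
  have hone : (1 : A) ∈ G.comp 0 := by simpa [hunit] using G.mul_mem htm htp
  refine G.sMul_comp_eq_of_one_mem_one_of_one_mem_neg_one
    (by simpa only [hunit] using mul_mem_sMul htm htp) ?_
  rw [← hfull] at hone
  refine (AddSubgroup.closure_le _).2 ?_ hone
  rintro _ ⟨r, hr, r', hr', rfl⟩
  have hl : r * tp ∈ G.comp (-1) := by simpa using G.mul_mem hr htp
  have hr : tm * r' ∈ G.comp 1 := by simpa using G.mul_mem htm hr'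
  simpa only [SetLike.mem_coe, mul_assoc] using mul_mem_sMul hl hr
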